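/- Suppose 𝒜₁₂ is faithful (to 𝒜 itself), 𝒜₂₁ = {0} (i.e. QAP = 0 for all A ∈ 𝒜), and C(𝒜, 𝒜) = 𝔽I. Then every C ∈ 𝒜 is a Jordan higher all-derivable point: every sequence {d_i}_{i∈ℕ} of linear maps on 𝒜 with d₀ = id_𝒜 that is Jordan higher derivable at C is a Jordan higher derivation. -/

import Mathlib

/-- The failure of `δ` to be a Jordan derivation, as a bilinear map. -/
def jordanDefect {𝔽 A : Type*} [Field 𝔽] [Ring A] [Algebra 𝔽 A] (δ : A →ₗ[𝔽] A) :
    A →ₗ[𝔽] A →ₗ[𝔽] A :=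
  LinearMap.mk₂ 𝔽 (fun a b => δ (a * b + b * a) - (δ a * b + b * δ a) - (a * δ b + δ b * a))
    (fun a a' b => by simp only [add_mul, mul_add, map_add]; abel)
    (fun c a b => by simp only [smul_mul_assoc, mul_smul_comm, map_smul, map_add, smul_sub, smul_add])
    (fun a b b' => by simp only [add_mul, mul_add, map_add]; abel)
    (fun c a b => by simp only [smul_mul_assoc, mul_smul_comm, map_smul, map_add, smul_sub, smul_add])

theorem jordanDefect_apply {𝔽 A : Type*} [Field 𝔽] [Ring A] [Algebra 𝔽 A] (δ : A →ₗ[𝔽] A)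
    (a b : A) : jordanDefect δ a b =
      δ (a * b + b * a) - (δ a * b + b * δ a) - (a * δ b + δ b * a) := rfl

theorem jordanDefect_comm {𝔽 A : Type*} [Field 𝔽] [Ring A] [Algebra 𝔽 A] (δ : A →ₗ[𝔽] A)
    (a b : A) : jordanDefect δ a b = jordanDefect δ b a := by
  simp only [jordanDefect_apply, add_comm (a * b)]; abel

/-- A bilinear map vanishing on all factorizations of `C`, evaluated on a family of factorizations
of `C` in a triangular algebra. -/
theorem apply_corner_factorization {𝔽 A B : Type*} [Field 𝔽] [Ring A] [Algebra 𝔽 A]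
    [AddCommGroup B] [Module 𝔽 B] {P Q C : A} (hP : P * P = P)
    (hPQ : P * Q = 0) (hQP : Q * P = 0) (h1 : P + Q = 1) (h21 : ∀ a : A, Q * a * P = 0)
    (f : A →ₗ[𝔽] A →ₗ[𝔽] B) (hf : ∀ a b, a * b = C → f a b = 0) {X X' Y Y' M : A}
    (hX' : X' = P * X' * P) (hXX' : X * X' = P) (hX : X = P * X * P)
    (hY : Y = Q * Y * Q) (hY' : Y' = Q * Y' * Q) (hYY' : Y' * Y = Q) (hM : M = P * M * Q) :
    f (X + M + Q * C * Q * Y') (X' * (P * C * P) + X' * (P * C * Q - M * Y) + Y) = 0 := by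
  apply hf
  have e1 : X * Y = 0 := by
    rw [hX, hY]; simp only [mul_assoc]; simp only [← mul_assoc P Q, hPQ, zero_mul, mul_zero]
  have e2 : M * X' = 0 := by
    rw [hM, hX']; simp only [mul_assoc]; simp only [← mul_assoc Q P, hQP, zero_mul, mul_zero]
  have e3 : Y' * X' = 0 := by
    rw [hY', hX']; simp only [mul_assoc]; simp only [← mul_assoc Q P, hQP, zero_mul, mul_zero]
  have e4 : P * M = M := by
    rw [hM]; simp only [← mul_assoc, hP]
  have hC : P * C * P + P * C * Q + Q * C * Q = C := by
    calc _ = (P + Q) * C * (P + Q) := by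
          simp only [add_mul, mul_add, h21]; abel
      _ = C := by rw [h1, one_mul, mul_one]
  have e5 : Q * Q = Q := by
    calc Q * Q = (P + Q) * Q - P * Q := by rw [add_mul]; abel
      _ = Q := by rw [h1, hPQ, one_mul, sub_zero]
  calc _ = (X * X') * (P * C * P) + (X * X') * (P * C * Q - M * Y) + X * Y
      + (M * X') * (P * C * P) + (M * X') * (P * C * Q - M * Y) + M * Y
      + Q * C * Q * ((Y' * X') * (P * C * P) + (Y' * X') * (P * C * Q - M * Y) + Y' * Y) := by
        noncomm_ring
    _ = (P * P) * C * P + (P * P) * C * Q - P * M * Y + M * Y + Q * C * (Q * Q) := by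
        rw [e1, e2, e3, hXX', hYY']; noncomm_ring
    _ = C := by rw [hP, e4, e5, sub_add_cancel]; exact hC

/-- Comparing coefficients in the identity of `apply_corner_factorization`. -/
theorem corner_identities {𝔽 A B : Type*} [Field 𝔽] [CharZero 𝔽] [Ring A] [Algebra 𝔽 A]
    [AddCommGroup B] [Module 𝔽 B] {P Q C : A} (hP : P * P = P)
    (hPQ : P * Q = 0) (hQP : Q * P = 0) (h1 : P + Q = 1) (h21 : ∀ a : A, Q * a * P = 0)
    (f : A →ₗ[𝔽] A →ₗ[𝔽] B) (hf : ∀ a b, a * b = C → f a b = 0) {X X' Y Y' M : A}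
    (hX' : X' = P * X' * P) (hXX' : X * X' = P) (hX : X = P * X * P)
    (hY : Y = Q * Y * Q) (hY' : Y' = Q * Y' * Q) (hYY' : Y' * Y = Q) (hM : M = P * M * Q) :
    f X Y = 0 ∧ f M Y = f X (X' * (M * Y)) ∧ f M (X' * (M * Y)) = 0 := by
  have key : ∀ s t m : 𝔽, s ≠ 0 → t ≠ 0 →
      f (s • X + m • M + Q * C * Q * (t⁻¹ • Y'))
        ((s⁻¹ • X') * (P * C * P) + (s⁻¹ • X') * (P * C * Q - (m • M) * (t • Y)) + t • Y) = 0 := by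
    intro s t m hs ht
    apply apply_corner_factorization hP hPQ hQP h1 h21 f hf
    · rw [mul_smul_comm, smul_mul_assoc, ← hX']
    · rw [smul_mul_smul_comm, mul_inv_cancel₀ hs, one_smul, hXX']
    · rw [mul_smul_comm, smul_mul_assoc, ← hX]
    · rw [mul_smul_comm, smul_mul_assoc, ← hY]
    · rw [mul_smul_comm, smul_mul_assoc, ← hY']
    · rw [smul_mul_smul_comm, inv_mul_cancel₀ ht, one_smul, hYY']
    · rw [mul_smul_comm, smul_mul_assoc, ← hM]
  have two : (2 : 𝔽) ≠ 0 := two_ne_zero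
  have k1 := key 1 1 0 one_ne_zero one_ne_zero
  have k2 := key (-1) 1 0 (neg_ne_zero.2 one_ne_zero) one_ne_zero
  have k3 := key 2 1 0 two one_ne_zero
  have k4 := key 1 1 1 one_ne_zero one_ne_zero
  have k5 := key 1 1 (-1) one_ne_zero one_ne_zero
  have k6 := key 1 (-1) 1 one_ne_zero (neg_ne_zero.2 one_ne_zero)
  clear key
  simp only [mul_sub, smul_mul_assoc, map_add, map_sub, map_smul,
    LinearMap.add_apply, LinearMap.smul_apply, inv_neg, inv_one, one_smul, zero_smul, neg_smul,
    map_neg, LinearMap.neg_apply, neg_mul, mul_neg, zero_mul, mul_zero, map_zero,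
    LinearMap.zero_apply, smul_add, smul_zero] at k1 k2 k3 k4 k5 k6
  refine ⟨?_, ?_, ?_⟩
  · linear_combination (norm := skip) (2 / 3 : 𝔽) • k3 - (1 / 2 : 𝔽) • k1 - (1 / 6 : 𝔽) • k2
    match_scalars <;> ring
  · linear_combination (norm := skip) (1 / 2 : 𝔽) • (k4 - k6) - (1 / 2 : 𝔽) • (k1 - k2) -
      ((1 / 2 : 𝔽) • (k4 + k5) - k1)
    match_scalars <;> ring
  · linear_combination (norm := skip) k1 - (1 / 2 : 𝔽) • (k4 + k5)
    match_scalars <;> ring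

theorem eq_zero_of_add_self (𝔽 : Type*) {B : Type*} [Field 𝔽] [CharZero 𝔽] [AddCommGroup B]
    [Module 𝔽 B] {x : B} (h : x + x = 0) : x = 0 := by
  rw [← two_smul 𝔽] at h
  exact (smul_eq_zero.1 h).resolve_left two_ne_zero

/-- The consequences of `corner_identities` extended linearly from invertible elements to the whole
diagonal corners. -/
theorem peirce_identities {𝔽 A : Type*} [Field 𝔽] [CharZero 𝔽] [Ring A] [Algebra 𝔽 A]
    {P Q C : A} (hP : P * P = P)
    (hPQ : P * Q = 0) (hQP : Q * P = 0) (h1 : P + Q = 1) (h21 : ∀ a : A, Q * a * P = 0)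
    (hinv₁ : ∀ a : A, P * a * P ∈ Submodule.span 𝔽
      {x : A | x = P * x * P ∧ ∃ y, y = P * y * P ∧ x * y = P ∧ y * x = P})
    (hinv₂ : ∀ a : A, Q * a * Q ∈ Submodule.span 𝔽
      {x : A | x = Q * x * Q ∧ ∃ y, y = Q * y * Q ∧ x * y = Q ∧ y * x = Q})
    (f : A →ₗ[𝔽] A →ₗ[𝔽] A) (hsymm : ∀ a b, f a b = f b a)
    (hf : ∀ a b, a * b = C → f a b = 0) :
    (∀ X Y, P * X = X → X * P = X → Q * Y = Y → Y * Q = Y → f X Y = 0) ∧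
    (∀ M Y, P * M = M → M * Q = M → Q * Y = Y → Y * Q = Y → f M Y = f P (M * Y)) ∧
    (∀ X M, P * X = X → X * P = X → P * M = M → M * Q = M → f (X * M) Q = f X M) ∧
    (∀ M N, P * M = M → M * Q = M → P * N = N → N * Q = N → f M N = 0) := by
  have hQ : Q * Q = Q := by
    calc Q * Q = (P + Q) * Q - P * Q := by rw [add_mul]; abel
      _ = Q := by rw [h1, hPQ, one_mul, sub_zero]
  have ids : ∀ {X X' Y Y' M : A}, X' = P * X' * P → X * X' = P → X = P * X * P →
      Y = Q * Y * Q → Y' = Q * Y' * Q → Y' * Y = Q → M = P * M * Q →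
      f X Y = 0 ∧ f M Y = f X (X' * (M * Y)) ∧ f M (X' * (M * Y)) = 0 :=
    corner_identities hP hPQ hQP h1 h21 f hf
  have hPPP : P = P * P * P := by rw [hP, hP]
  have hQQQ : Q = Q * Q * Q := by rw [hQ, hQ]
  have span₁ : ∀ X, P * X = X → X * P = X → X ∈ Submodule.span 𝔽
      {x : A | x = P * x * P ∧ ∃ y, y = P * y * P ∧ x * y = P ∧ y * x = P} := by
    intro X h h'
    have := hinv₁ X
    rwa [h, h'] at this
  have span₂ : ∀ Y, Q * Y = Y → Y * Q = Y → Y ∈ Submodule.span 𝔽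
      {x : A | x = Q * x * Q ∧ ∃ y, y = Q * y * Q ∧ x * y = Q ∧ y * x = Q} := by
    intro Y h h'
    have := hinv₂ Y
    rwa [h, h'] at this
  have corner : ∀ M, P * M = M → M * Q = M → M = P * M * Q := by
    intro M h h'
    rw [h, h']
  have hMM : ∀ M, P * M = M → M * Q = M → f M M = 0 := by
    intro M h h'
    have := (ids hPPP hP hPPP hQQQ hQQQ hQ (corner M h h')).2.2
    rwa [h', h] at this
  refine ⟨?_, ?_, ?_, ?_⟩
  · intro X Y hX hX' hY hY'
    refine LinearMap.eqOn_span (f := f X) (g := 0) ?_ (span₂ Y hY hY')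
    rintro y ⟨hy, y', hy', -, hyy'⟩
    refine LinearMap.eqOn_span (f := f.flip y) (g := 0) ?_ (span₁ X hX hX')
    rintro x ⟨hx, x', hx', hxx', -⟩
    exact (ids (M := 0) hx' hxx' hx hy hy' hyy' (by simp)).1
  · intro M Y hM hM' hY hY'
    refine LinearMap.eqOn_span (f := f M) (g := f P ∘ₗ LinearMap.mulLeft 𝔽 M) ?_ (span₂ Y hY hY')
    rintro y ⟨hy, y', hy', -, hyy'⟩
    have := (ids hPPP hP hPPP hy hy' hyy' (corner M hM hM')).2.1
    rwa [← mul_assoc P, hM] at this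
  · intro X M hX hX' hM hM'
    refine LinearMap.eqOn_span (f := f.flip Q ∘ₗ LinearMap.mulRight 𝔽 M) (g := f.flip M) ?_
      (span₁ X hX hX')
    rintro x ⟨hx, x', hx', hxx', hx'x⟩
    have hPx : P * x = x := by rw [hx, ← mul_assoc, ← mul_assoc, hP]
    have := (ids hx' hxx' hx hQQQ hQQQ hQ
      (corner (x * M) (by rw [← mul_assoc, hPx]) (by rw [mul_assoc, hM']))).2.1
    rw [mul_assoc x, hM', ← mul_assoc x', hx'x, hM] at this
    exact this
  · intro M N hM hM' hN hN'
    apply eq_zero_of_add_self 𝔽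
    have h := hMM (M + N) (by rw [mul_add, hM, hN]) (by rw [add_mul, hM', hN'])
    simp only [map_add, LinearMap.add_apply, hMM M hM hM', hMM N hN hN', hsymm N M, add_zero,
      zero_add] at h
    exact h

/-- If `1` is a sum of idempotents `P`, `Q` with `Q A P = 0`, the off-diagonal corner is faithful,
the diagonal corners are spanned by their units and the center is trivial, then a linear map that is Jordan
derivable at some point `C` is a Jordan derivation. -/
theorem jordanDefect_eq_zero {𝔽 A : Type*} [Field 𝔽] [CharZero 𝔽] [Ring A] [Algebra 𝔽 A]
    {P Q C : A} (hP : P * P = P) (hP0 : P ≠ 0)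
    (hPQ : P * Q = 0) (hQP : Q * P = 0) (h1 : P + Q = 1) (h21 : ∀ a : A, Q * a * P = 0)
    (hinv₁ : ∀ a : A, P * a * P ∈ Submodule.span 𝔽
      {x : A | x = P * x * P ∧ ∃ y, y = P * y * P ∧ x * y = P ∧ y * x = P})
    (hinv₂ : ∀ a : A, Q * a * Q ∈ Submodule.span 𝔽
      {x : A | x = Q * x * Q ∧ ∃ y, y = Q * y * Q ∧ x * y = Q ∧ y * x = Q})
    (hlf : ∀ N : A, (∀ a : A, N * (P * a * Q) = 0) → N * P = 0)
    (hrf : ∀ N : A, (∀ a : A, (P * a * Q) * N = 0) → Q * N = 0)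
    (hcenter : ∀ N : A, (∀ a : A, a * N = N * a) → ∃ k : 𝔽, N = k • (1 : A))
    (δ : A →ₗ[𝔽] A) (hδ : ∀ a b, a * b = C → jordanDefect δ a b = 0) (a b : A) :
    jordanDefect δ a b = 0 := by
  have hQ : Q * Q = Q := by
    calc Q * Q = (P + Q) * Q - P * Q := by rw [add_mul]; abel
      _ = Q := by rw [h1, hPQ, one_mul, sub_zero]
  obtain ⟨i1, i2, i3, i4⟩ := peirce_identities hP hPQ hQP h1 h21 hinv₁ hinv₂ (jordanDefect δ)
    (jordanDefect_comm δ) hδ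
  -- multiplication rules between the corners
  have split_left : ∀ z : A, P * z + Q * z = z := fun z => by rw [← add_mul, h1, one_mul]
  have split_right : ∀ z : A, z * P + z * Q = z := fun z => by rw [← mul_add, h1, mul_one]
  have QzQ : ∀ z : A, Q * z * Q = Q * z := fun z => by
    have := split_right (Q * z)
    rwa [h21, zero_add] at this
  have PzP : ∀ z : A, P * z * P = z * P := fun z => by
    have := split_left (z * P)
    rwa [← mul_assoc, ← mul_assoc, h21, add_zero] at this
  have Q_left : ∀ {X : A}, P * X = X → Q * X = 0 := fun {X} h => by
    rw [← h, ← mul_assoc, hQP, zero_mul]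
  have Q_right : ∀ {X : A}, X * P = X → X * Q = 0 := fun {X} h => by
    rw [← h, mul_assoc, hPQ, mul_zero]
  have P_left : ∀ {Y : A}, Q * Y = Y → P * Y = 0 := fun {X} h => by
    rw [← h, ← mul_assoc, hPQ, zero_mul]
  have P_right : ∀ {Y : A}, Y * Q = Y → Y * P = 0 := fun {X} h => by
    rw [← h, mul_assoc, hQP, mul_zero]
  have mul_P : ∀ {z X : A}, z * P = 0 → P * X = X → z * X = 0 := fun {z X} h h' => by
    rw [← h', ← mul_assoc, h, zero_mul]
  have mul_Q : ∀ {z Y : A}, Q * z = 0 → Y * Q = Y → Y * z = 0 := fun {z Y} h h' => by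
    rw [← h', mul_assoc, h, mul_zero]
  have mul_diag : ∀ {X Y : A}, X * P = X → Q * Y = Y → X * Y = 0 := fun {X Y} h h' => by
    rw [← h, mul_assoc, P_left h', mul_zero]
  -- the images of the diagonal corners
  have QδX : ∀ X, P * X = X → X * P = X → Q * δ X = 0 := by
    intro X h h'
    apply eq_zero_of_add_self 𝔽
    have e : Q * δ Q * X = 0 := mul_P (h21 _) h
    have : Q * δ X + Q * δ X = -(Q * jordanDefect δ X Q) := by
      simp only [jordanDefect_apply, Q_left h, Q_right h', mul_sub, mul_add, ← mul_assoc, QzQ, e,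
        hQ, map_zero, mul_zero, zero_mul, add_zero]
      abel
    rw [this, i1 X Q h h' hQ hQ, mul_zero, neg_zero]
  have δYP : ∀ Y, Q * Y = Y → Y * Q = Y → δ Y * P = 0 := by
    intro Y h h'
    apply eq_zero_of_add_self 𝔽
    have e : Y * δ P * P = 0 := by
      rw [mul_assoc]; exact mul_Q (by rw [← mul_assoc, h21]) h'
    have : δ Y * P + δ Y * P = -(jordanDefect δ P Y * P) := by
      simp only [jordanDefect_apply, P_left h, P_right h', sub_mul, add_mul, PzP, e,
        map_zero, zero_mul, add_zero]
      simp only [mul_assoc, P_right h', hP, mul_zero]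
      abel
    rw [this, i1 P Y hP hP h h', zero_mul, neg_zero]
  have δXQ : ∀ X, P * X = X → X * P = X → δ X * Q = -(X * δ Q) := by
    intro X h h'
    have : δ X * Q + X * δ Q = -jordanDefect δ X Q := by
      simp only [jordanDefect_apply, Q_left h, Q_right h', QδX X h h', mul_P (δYP Q hQ hQ) h,
        map_zero, add_zero]
      abel
    rw [i1 X Q h h' hQ hQ, neg_zero] at this
    exact eq_neg_of_add_eq_zero_left this
  have PδY : ∀ Y, Q * Y = Y → Y * Q = Y → P * δ Y = -(δ P * Y) := by
    intro Y h h'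
    have : P * δ Y + δ P * Y = -jordanDefect δ P Y := by
      simp only [jordanDefect_apply, P_left h, P_right h', δYP Y h h', mul_Q (QδX P hP hP) h',
        map_zero, add_zero]
      abel
    rw [i1 P Y hP hP h h', neg_zero] at this
    exact eq_neg_of_add_eq_zero_left this
  -- the images of the off-diagonal corner
  have defectMQ : ∀ M, P * M = M → M * Q = M →
      jordanDefect δ M Q = δ M - (δ M * Q + Q * δ M) - M * δ Q := by
    intro M h h'
    rw [jordanDefect_apply, h', Q_left h, mul_P (δYP Q hQ hQ) h, add_zero, add_zero]
  have defectPM : ∀ M, P * M = M → M * Q = M →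
      jordanDefect δ P M = δ M - δ P * M - (P * δ M + δ M * P) := by
    intro M h h'
    rw [jordanDefect_apply, h, P_right h', mul_Q (QδX P hP hP) h', add_zero, add_zero]
  have defect_eq : ∀ M, P * M = M → M * Q = M → jordanDefect δ M Q = jordanDefect δ P M := by
    intro M h h'
    have := i3 P M hP hP h h'
    rwa [h] at this
  have QδM : ∀ M, P * M = M → M * Q = M → Q * δ M = 0 := by
    intro M h h'
    apply eq_zero_of_add_self 𝔽
    have e : Q * δ P * M = 0 := mul_P (h21 _) h
    have : Q * δ M + Q * δ M = Q * jordanDefect δ P M - Q * jordanDefect δ M Q := by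
      rw [defectMQ M h h', defectPM M h h']
      simp only [mul_sub, mul_add, ← mul_assoc, QzQ, h21, hQ, hQP, Q_left h, e, zero_mul]
      abel
    rw [this, defect_eq M h h', sub_self]
  have δMP : ∀ M, P * M = M → M * Q = M → δ M * P = 0 := by
    intro M h h'
    apply eq_zero_of_add_self 𝔽
    have e : δ P * M * P = 0 := by rw [mul_assoc, P_right h', mul_zero]
    have e' : M * δ Q * P = 0 := by rw [mul_assoc, δYP Q hQ hQ, mul_zero]
    have : δ M * P + δ M * P = jordanDefect δ M Q * P - jordanDefect δ P M * P := by
      rw [defectMQ M h h', defectPM M h h']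
      simp only [sub_mul, add_mul, h21, PzP, e, e']
      simp only [mul_assoc, hP, hQP, mul_zero]
      abel
    rw [this, defect_eq M h h', sub_self]
  have δMQ : ∀ M, P * M = M → M * Q = M → δ M * Q = δ M := by
    intro M h h'
    have := split_right (δ M)
    rwa [δMP M h h', zero_add] at this
  have PδM : ∀ M, P * M = M → M * Q = M → P * δ M = δ M := by
    intro M h h'
    have := split_left (δ M)
    rwa [QδM M h h', add_zero] at this
  have MδQ : ∀ M, P * M = M → M * Q = M → δ P * M = M * δ Q := by
    intro M h h'
    have := defect_eq M h h'
    rw [defectMQ M h h', defectPM M h h', δMQ M h h', PδM M h h', QδM M h h', δMP M h h'] at this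
    simp only [add_zero, sub_self, zero_sub, sub_sub_cancel_left] at this
    exact (neg_injective this).symm
  -- the diagonal part of `δ P + δ Q` is central
  have PaQ : ∀ a, P * (P * a * Q) = P * a * Q ∧ (P * a * Q) * Q = P * a * Q := by
    intro a
    constructor
    · rw [← mul_assoc, ← mul_assoc, hP]
    · rw [mul_assoc, hQ]
  have commX : ∀ X, P * X = X → X * P = X → X * (δ P * P) = δ P * X := by
    intro X h h'
    have := hlf (X * δ P - δ P * X) fun a => by
      obtain ⟨m, m'⟩ := PaQ a
      generalize P * a * Q = M at *
      rw [sub_mul, mul_assoc, MδQ _ m m', mul_assoc (δ P), MδQ (X * M), mul_assoc,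
        sub_self]
      · rw [← mul_assoc, h]
      · rw [mul_assoc, m']
    rwa [sub_mul, mul_assoc (δ P), h', mul_assoc, sub_eq_zero] at this
  have commY : ∀ Y, Q * Y = Y → Y * Q = Y → Y * δ Q = Q * δ Q * Y := by
    intro Y h h'
    have := hrf (Y * δ Q - δ Q * Y) fun a => by
      obtain ⟨m, m'⟩ := PaQ a
      rw [mul_sub, ← mul_assoc, ← mul_assoc, ← MδQ _ m m', mul_assoc (δ P),
        ← MδQ (P * a * Q * Y), sub_self]
      · rw [← mul_assoc, m]
      · rw [mul_assoc, h']
    rwa [mul_sub, ← mul_assoc, h, ← mul_assoc, sub_eq_zero] at this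
  have decomp : ∀ z : A, P * z * P + P * z * Q + Q * z * Q = z := fun z => by
    rw [split_right, QzQ, split_left]
  obtain ⟨k, hk⟩ : ∃ k : 𝔽, δ P * P + Q * δ Q = k • (1 : A) := by
    refine hcenter _ fun a => ?_
    obtain ⟨m, m'⟩ := PaQ a
    have hx : P * (P * a * P) = P * a * P := by rw [← mul_assoc, ← mul_assoc, hP]
    have hx' : P * a * P * P = P * a * P := by rw [mul_assoc, hP]
    have hy : Q * (Q * a * Q) = Q * a * Q := by rw [← mul_assoc, ← mul_assoc, hQ]
    have hy' : Q * a * Q * Q = Q * a * Q := by rw [mul_assoc, hQ]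
    have hv := QδX P hP hP
    have hu : Q * δ Q * P = 0 := h21 _
    rw [← decomp a]
    generalize P * a * P = X at *
    generalize P * a * Q = M at *
    generalize Q * a * Q = Y at *
    have t1 : X * (Q * δ Q) = 0 := by rw [← mul_assoc, Q_right hx', zero_mul]
    have t2 : M * (δ P * P) = 0 := by rw [← mul_assoc, mul_Q hv m', zero_mul]
    have t3 : Y * (δ P * P) = 0 := by rw [← mul_assoc, mul_Q hv hy', zero_mul]
    have t4 : M * (Q * δ Q) = M * δ Q := by rw [← mul_assoc, m']
    have t5 : Y * (Q * δ Q) = Y * δ Q := by rw [← mul_assoc, hy']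
    have t6 : δ P * P * X = δ P * X := by rw [mul_assoc, hx]
    have t7 : δ P * P * M = δ P * M := by rw [mul_assoc, m]
    have t8 : δ P * P * Y = 0 := by rw [mul_assoc, P_left hy, mul_zero]
    simp only [add_mul, mul_add, t1, t2, t3, t4, t5, t6, t7, t8, mul_P hu hx, mul_P hu m,
      commX X hx hx', commY Y hy hy', MδQ M m m']
    abel
  have Mu : ∀ M, P * M = M → M * Q = M → M * δ Q = k • M := by
    intro M h h'
    have := congrArg (M * ·) hk
    simp only [mul_add, ← mul_assoc, h', mul_Q (QδX P hP hP) h', zero_mul, zero_add,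
      mul_smul_comm, mul_one] at this
    exact this
  have fMQ : ∀ M, P * M = M → M * Q = M → jordanDefect δ M Q = -(k • M) := by
    intro M h h'
    rw [defectMQ M h h', δMQ M h h', QδM M h h', Mu M h h', add_zero, sub_self, zero_sub]
  have fXM : ∀ X M, P * X = X → X * P = X → P * M = M → M * Q = M →
      jordanDefect δ X M = -(k • (X * M)) := by
    intro X M hX hX' hM hM'
    rw [← i3 X M hX hX' hM hM', fMQ]
    · rw [← mul_assoc, hX]
    · rw [mul_assoc, hM']
  have fMY : ∀ M Y, P * M = M → M * Q = M → Q * Y = Y → Y * Q = Y →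
      jordanDefect δ M Y = -(k • (M * Y)) := by
    intro M Y hM hM' hY hY'
    have h : P * (M * Y) = M * Y := by rw [← mul_assoc, hM]
    rw [i2 M Y hM hM' hY hY', fXM P _ hP hP h (by rw [mul_assoc, hY']), h]
  -- `δ` is, up to `k`, a derivation on products with the off-diagonal corner
  have δXM : ∀ X M, P * X = X → X * P = X → P * M = M → M * Q = M →
      δ X * M = δ (X * M) - X * δ M + k • (X * M) := by
    intro X M hX hX' hM hM'
    have := fXM X M hX hX' hM hM'
    rw [jordanDefect_apply, mul_P (P_right hM') hX, mul_Q (QδX X hX hX') hM',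
      mul_P (δMP M hM hM') hX, add_zero, add_zero, add_zero] at this
    rw [← neg_eq_iff_eq_neg.2 this]
    abel
  have δMY : ∀ M Y, P * M = M → M * Q = M → Q * Y = Y → Y * Q = Y →
      M * δ Y = δ (M * Y) - δ M * Y + k • (M * Y) := by
    intro M Y hM hM' hY hY'
    have := fMY M Y hM hM' hY hY'
    rw [jordanDefect_apply, mul_Q (Q_left hM) hY', mul_Q (QδM M hM hM') hY',
      mul_P (δYP Y hY hY') hM, add_zero, add_zero, add_zero] at this
    rw [← neg_eq_iff_eq_neg.2 this]
    abel
  -- hence also on the diagonal corners, by faithfulness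
  have δXX : ∀ X Z, P * X = X → X * P = X → P * Z = Z → Z * P = Z →
      δ (X * Z) = δ X * Z + X * δ Z - k • (X * Z) := by
    intro X Z hX hX' hZ hZ'
    have hXZ : P * (X * Z) = X * Z := by rw [← mul_assoc, hX]
    have hXZ' : X * Z * P = X * Z := by rw [mul_assoc, hZ']
    have hl := hlf (δ (X * Z) - (δ X * Z + X * δ Z - k • (X * Z))) fun a => by
      obtain ⟨m, m'⟩ := PaQ a
      generalize P * a * Q = M at *
      have hZM : P * (Z * M) = Z * M := by rw [← mul_assoc, hZ]
      have hZM' : Z * M * Q = Z * M := by rw [mul_assoc, m']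
      simp only [sub_mul, add_mul, smul_mul_assoc]
      rw [δXM (X * Z) M hXZ hXZ' m m', mul_assoc (δ X), δXM X (Z * M) hX hX' hZM hZM',
        mul_assoc X (δ Z), δXM Z M hZ hZ' m m']
      simp only [mul_add, mul_sub, mul_smul_comm, mul_assoc]
      abel
    have hr : (δ (X * Z) - (δ X * Z + X * δ Z - k • (X * Z))) * Q = 0 := by
      simp only [sub_mul, add_mul, smul_mul_assoc]
      rw [δXQ (X * Z) hXZ hXZ', mul_assoc (δ X), Q_right hZ', mul_assoc X (δ Z), δXQ Z hZ hZ',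
        Q_right hXZ', mul_neg, mul_assoc]
      simp
    have := split_right (δ (X * Z) - (δ X * Z + X * δ Z - k • (X * Z)))
    rw [hl, hr, add_zero] at this
    exact sub_eq_zero.1 this.symm
  have δYY : ∀ Y Z, Q * Y = Y → Y * Q = Y → Q * Z = Z → Z * Q = Z →
      δ (Y * Z) = δ Y * Z + Y * δ Z - k • (Y * Z) := by
    intro Y Z hY hY' hZ hZ'
    have hYZ : Q * (Y * Z) = Y * Z := by rw [← mul_assoc, hY]
    have hYZ' : Y * Z * Q = Y * Z := by rw [mul_assoc, hZ']
    have hr := hrf (δ (Y * Z) - (δ Y * Z + Y * δ Z - k • (Y * Z))) fun a => by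
      obtain ⟨m, m'⟩ := PaQ a
      generalize P * a * Q = M at *
      have hMY : P * (M * Y) = M * Y := by rw [← mul_assoc, m]
      have hMY' : M * Y * Q = M * Y := by rw [mul_assoc, hY']
      simp only [mul_sub, mul_add, mul_smul_comm]
      rw [δMY M (Y * Z) m m' hYZ hYZ', ← mul_assoc M (δ Y), δMY M Y m m' hY hY',
        ← mul_assoc M Y (δ Z), δMY (M * Y) Z hMY hMY' hZ hZ']
      simp only [add_mul, sub_mul, smul_mul_assoc, mul_assoc]
      abel
    have hl : P * (δ (Y * Z) - (δ Y * Z + Y * δ Z - k • (Y * Z))) = 0 := by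
      simp only [mul_sub, mul_add, mul_smul_comm]
      rw [PδY (Y * Z) hYZ hYZ', ← mul_assoc P (δ Y), PδY Y hY hY', ← mul_assoc P Y,
        P_left hY, P_left hYZ, neg_mul, mul_assoc]
      simp
    have := split_left (δ (Y * Z) - (δ Y * Z + Y * δ Z - k • (Y * Z)))
    rw [hl, hr, add_zero] at this
    exact sub_eq_zero.1 this.symm
  have fXX : ∀ X Z, P * X = X → X * P = X → P * Z = Z → Z * P = Z →
      jordanDefect δ X Z = -(k • (X * Z + Z * X)) := by
    intro X Z hX hX' hZ hZ'
    rw [jordanDefect_apply, map_add, δXX X Z hX hX' hZ hZ', δXX Z X hZ hZ' hX hX', smul_add]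
    abel
  have fYY : ∀ Y Z, Q * Y = Y → Y * Q = Y → Q * Z = Z → Z * Q = Z →
      jordanDefect δ Y Z = -(k • (Y * Z + Z * Y)) := by
    intro Y Z hY hY' hZ hZ'
    rw [jordanDefect_apply, map_add, δYY Y Z hY hY' hZ hZ', δYY Z Y hZ hZ' hY hY', smul_add]
    abel
  have f_eq : ∀ a b, jordanDefect δ a b = -(k • (a * b + b * a)) := by
    intro a b
    have hx : ∀ z, P * (P * z * P) = P * z * P := fun z => by rw [← mul_assoc, ← mul_assoc, hP]
    have hx' : ∀ z, P * z * P * P = P * z * P := fun z => by rw [mul_assoc, hP]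
    have hy : ∀ z, Q * (Q * z * Q) = Q * z * Q := fun z => by rw [← mul_assoc, ← mul_assoc, hQ]
    have hy' : ∀ z, Q * z * Q * Q = Q * z * Q := fun z => by rw [mul_assoc, hQ]
    have hX := hx a
    have hX' := hx' a
    have hY := hy a
    have hY' := hy' a
    obtain ⟨hM, hM'⟩ := PaQ a
    have hR := hx b
    have hR' := hx' b
    have hT := hy b
    have hT' := hy' b
    obtain ⟨hS, hS'⟩ := PaQ b
    rw [← decomp a, ← decomp b]
    generalize P * a * P = X at *
    generalize P * a * Q = M at *
    generalize Q * a * Q = Y at *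
    generalize P * b * P = R at *
    generalize P * b * Q = S at *
    generalize Q * b * Q = T at *
    simp only [map_add, LinearMap.add_apply, fXX X R hX hX' hR hR', fXM X S hX hX' hS hS',
      i1 X T hX hX' hT hT', jordanDefect_comm δ M R, fXM R M hR hR' hM hM', i4 M S hM hM' hS hS',
      fMY M T hM hM' hT hT', jordanDefect_comm δ Y R, i1 R Y hR hR' hY hY',
      jordanDefect_comm δ Y S, fMY S Y hS hS' hY hY', fYY Y T hY hY' hT hT',
      mul_add, add_mul, mul_P (P_right hS') hX, mul_P (P_right hT') hX, mul_P (P_right hM') hR,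
      mul_P (P_right hY') hR, mul_P (P_right hM') hS, mul_P (P_right hS') hM,
      mul_P (P_right hY') hS, mul_P (P_right hT') hM,
      mul_diag hX' hT, mul_diag hR' hY, smul_add, add_zero, zero_add]
    abel
  -- finally `k = 0`
  rw [f_eq]
  by_cases hk0 : k = 0
  · rw [hk0, zero_smul, neg_zero]
  exfalso
  have zero_of : ∀ a b, a * b = C → a * b + b * a = 0 := by
    intro a b h
    have := f_eq a b
    rw [hδ a b h, eq_comm, neg_eq_zero] at this
    exact (smul_eq_zero.1 this).resolve_left hk0
  have hC : C = 0 := by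
    have := zero_of C 1 (mul_one C)
    rw [mul_one, one_mul] at this
    exact eq_zero_of_add_self 𝔽 this
  apply hP0
  rw [← hP]
  refine hlf P fun a => ?_
  obtain ⟨m, m'⟩ := PaQ a
  have := zero_of Q (P * a * Q) (by rw [hC, Q_left m])
  rw [Q_left m, zero_add, m'] at this
  rw [m, this]

open Finset.HasAntidiagonal (antidiagonal mem_antidiagonal)

theorem sum_antidiagonal_assoc {B : Type*} [AddCommMonoid B] (F : ℕ → ℕ → ℕ → B) (n : ℕ) :
    ∑ p ∈ antidiagonal n, ∑ q ∈ antidiagonal p.2, F p.1 q.1 q.2 =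
      ∑ p ∈ antidiagonal n, ∑ q ∈ antidiagonal p.1, F q.1 q.2 p.2 := by
  simp only [Finset.sum_sigma']
  refine Finset.sum_nbij' (fun x => ⟨(x.1.1 + x.2.1, x.2.2), (x.1.1, x.2.1)⟩)
    (fun x => ⟨(x.2.1, x.2.2 + x.1.2), (x.2.2, x.1.2)⟩) ?_ ?_ ?_ ?_ ?_
  all_goals
    rintro ⟨⟨i, j⟩, ⟨k, l⟩⟩ h
    simp only [Finset.mem_sigma, mem_antidiagonal] at h
    obtain ⟨h, rfl⟩ := h
  · simp [← h, add_assoc]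
  · simp [← h, add_assoc]
  all_goals rfl

/-- The sequence `δ` determined by `n • d n = ∑ i ∈ range (n + 1), δ i ∘ d (n - i)` when
`d 0 = id`: the logarithmic derivative of the generating function of `d`. -/
noncomputable def logDerivative {𝔽 A : Type*} [Field 𝔽] [Ring A] [Algebra 𝔽 A]
    (d : ℕ → (A →ₗ[𝔽] A)) : ℕ → (A →ₗ[𝔽] A)
  | n => n • d n - ∑ i : Fin n, logDerivative d i ∘ₗ d (n - i)
decreasing_by exact i.2

theorem sum_logDerivative {𝔽 A : Type*} [Field 𝔽] [Ring A] [Algebra 𝔽 A]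
    {d : ℕ → (A →ₗ[𝔽] A)} (hd : d 0 = LinearMap.id) (n : ℕ) (a : A) :
    ∑ p ∈ antidiagonal n, logDerivative d p.1 (d p.2 a) = n • d n a := by
  rw [Finset.Nat.sum_antidiagonal_eq_sum_range_succ (fun i j => logDerivative d i (d j a)),
    Finset.sum_range_succ, Nat.sub_self, hd, LinearMap.id_apply]
  have h : logDerivative d n = n • d n - ∑ i : Fin n, logDerivative d i ∘ₗ d (n - i) := by
    rw [logDerivative]
  rw [h, LinearMap.sub_apply, LinearMap.sum_apply, Fin.sum_univ_eq_sum_range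
    (fun i => (logDerivative d i ∘ₗ d (n - i)) a)]
  simp

theorem logDerivative_zero {𝔽 A : Type*} [Field 𝔽] [Ring A] [Algebra 𝔽 A]
    (d : ℕ → (A →ₗ[𝔽] A)) : logDerivative d 0 = 0 := by
  rw [logDerivative]; simp

/-- The failure of the `n`-th identity of a Jordan higher derivation agrees, up to the factor `n`,
with the failure of `logDerivative d n` to be a Jordan derivation, once all earlier terms are
well behaved. -/
theorem jordanDefect_logDerivative {𝔽 A : Type*} [Field 𝔽] [Ring A] [Algebra 𝔽 A]
    {d : ℕ → (A →ₗ[𝔽] A)} (hd : d 0 = LinearMap.id) (n : ℕ)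
    (hlt : ∀ m < n, ∀ a b : A, d m (a * b + b * a) =
      ∑ p ∈ antidiagonal m, (d p.1 a * d p.2 b + d p.2 b * d p.1 a))
    (hδ : ∀ m < n, ∀ a b : A, jordanDefect (logDerivative d m) a b = 0) (a b : A) :
    jordanDefect (logDerivative d n) a b = n • (d n (a * b + b * a) -
      ∑ p ∈ antidiagonal n, (d p.1 a * d p.2 b + d p.2 b * d p.1 a)) := by
  set δ := logDerivative d with hδ_def
  have hδ' : ∀ m < n, ∀ a b : A, δ m (a * b + b * a) =
      (δ m a * b + b * δ m a) + (a * δ m b + δ m b * a) := by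
    intro m hm a b
    have := hδ m hm a b
    rw [jordanDefect_apply, sub_sub, sub_eq_zero] at this
    exact this
  let T : ℕ × ℕ → A := fun p => ∑ q ∈ antidiagonal p.2,
    ((δ p.1 (d q.1 a) * d q.2 b + d q.2 b * δ p.1 (d q.1 a)) +
      (d q.1 a * δ p.1 (d q.2 b) + δ p.1 (d q.2 b) * d q.1 a))
  have hT : ∑ p ∈ antidiagonal n, T p =
      n • ∑ p ∈ antidiagonal n, (d p.1 a * d p.2 b + d p.2 b * d p.1 a) := by
    have e1 : ∑ p ∈ antidiagonal n, ∑ q ∈ antidiagonal p.2,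
        (δ p.1 (d q.1 a) * d q.2 b + d q.2 b * δ p.1 (d q.1 a)) =
        ∑ p ∈ antidiagonal n, p.1 • (d p.1 a * d p.2 b + d p.2 b * d p.1 a) := by
      rw [sum_antidiagonal_assoc (fun i j k => δ i (d j a) * d k b + d k b * δ i (d j a))]
      refine Finset.sum_congr rfl fun p _ => ?_
      rw [Finset.sum_add_distrib, ← Finset.sum_mul, ← Finset.mul_sum, sum_logDerivative hd,
        smul_mul_assoc, mul_smul_comm, smul_add]
    have e2 : ∑ p ∈ antidiagonal n, ∑ q ∈ antidiagonal p.2,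
        (d q.1 a * δ p.1 (d q.2 b) + δ p.1 (d q.2 b) * d q.1 a) =
        ∑ p ∈ antidiagonal n, p.2 • (d p.1 a * d p.2 b + d p.2 b * d p.1 a) := by
      have swap : ∀ p : ℕ × ℕ, ∑ q ∈ antidiagonal p.2,
          (d q.1 a * δ p.1 (d q.2 b) + δ p.1 (d q.2 b) * d q.1 a) =
          ∑ q ∈ antidiagonal p.2,
          (d q.2 a * δ p.1 (d q.1 b) + δ p.1 (d q.1 b) * d q.2 a) := fun p =>
        (Finset.Nat.sum_antidiagonal_swap (n := p.2) (f := fun q =>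
          d q.1 a * δ p.1 (d q.2 b) + δ p.1 (d q.2 b) * d q.1 a)).symm
      rw [Finset.sum_congr rfl fun p _ => swap p,
        sum_antidiagonal_assoc (fun i j k => d k a * δ i (d j b) + δ i (d j b) * d k a),
        ← Finset.Nat.sum_antidiagonal_swap]
      refine Finset.sum_congr rfl fun p _ => ?_
      rw [Finset.sum_add_distrib, ← Finset.sum_mul, ← Finset.mul_sum, Prod.fst_swap,
        Prod.snd_swap, sum_logDerivative hd, smul_mul_assoc, mul_smul_comm, smul_add]
    simp only [T, Finset.sum_add_distrib (f := fun q : ℕ × ℕ => _ + _)]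
    rw [Finset.sum_add_distrib, e1, e2, ← Finset.sum_add_distrib, Finset.smul_sum]
    refine Finset.sum_congr rfl fun p hp => ?_
    rw [← add_smul, mem_antidiagonal.1 hp]
  have hd' : ∑ p ∈ antidiagonal n, δ p.1 (d p.2 (a * b + b * a)) =
      n • d n (a * b + b * a) := sum_logDerivative hd n _
  have hterm : ∀ i < n, δ i (d (n - i) (a * b + b * a)) = T (i, n - i) := by
    intro i hi
    rcases Nat.eq_zero_or_pos i with rfl | hpos
    · simp [T, hδ_def, logDerivative_zero]
    · rw [hlt (n - i) (by omega), map_sum]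
      exact Finset.sum_congr rfl fun q _ => hδ' i hi _ _
  rw [Finset.Nat.sum_antidiagonal_eq_sum_range_succ_mk, Finset.sum_range_succ] at hd' hT
  rw [smul_sub, ← hd', ← hT, Finset.sum_congr rfl fun i hi => hterm i (Finset.mem_range.1 hi),
    add_sub_add_left_eq_sub, jordanDefect_apply, sub_sub]
  simp [T, hd]


/-- suppose `𝒜₁₂` is faithful (to `𝒜` itself), `𝒜₂₁ = {0}` and
`C(𝒜, 𝒜) = 𝔽I`. Then every `C ∈ 𝒜` is a Jordan higher all-derivable point: every
sequence `{dᵢ}` of linear maps on `𝒜` with `d₀ = id` that is Jordan higher derivable at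
`C` is a Jordan higher derivation. -/
theorem statement15 {𝔽 A : Type*} [Field 𝔽] [CharZero 𝔽] [Ring A] [Algebra 𝔽 A]
    -- `P` is a nontrivial idempotent, `Q = 1 - P`
    (P Q : A) (hP : P * P = P) (hP0 : P ≠ 0) (hP1 : P ≠ 1) (hQ : Q = 1 - P)
    -- every element of `𝒜₁₁` is a linear combination of elements invertible in `𝒜₁₁`
    (hinv₁ : ∀ a : A, P * a * P ∈ Submodule.span 𝔽
      {x : A | x = P * x * P ∧ ∃ y, y = P * y * P ∧ x * y = P ∧ y * x = P})
    -- every element of `𝒜₂₂` is a linear combination of elements invertible in `𝒜₂₂`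
    (hinv₂ : ∀ a : A, Q * a * Q ∈ Submodule.span 𝔽
      {x : A | x = Q * x * Q ∧ ∃ y, y = Q * y * Q ∧ x * y = Q ∧ y * x = Q})
    -- `𝒜₁₂` is faithful
    (hlf : ∀ N : A, (∀ a : A, N * (P * a * Q) = 0) → N * P = 0)
    (hrf : ∀ N : A, (∀ a : A, (P * a * Q) * N = 0) → Q * N = 0)
    -- `𝒜₂₁ = {0}`
    (h21 : ∀ a : A, Q * a * P = 0)
    -- `C(𝒜, 𝒜) = 𝔽I`
    (hcenter : ∀ N : A, (∀ a : A, a * N = N * a) → ∃ k : 𝔽, N = k • (1 : A)) :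
    -- every `C ∈ 𝒜` is a Jordan higher all-derivable point
    ∀ C : A, ∀ d : ℕ → (A →ₗ[𝔽] A), d 0 = LinearMap.id →
      (∀ n : ℕ, ∀ a b : A, a * b = C → d n (a * b + b * a) =
        ∑ i ∈ Finset.range (n + 1), (d i a * d (n - i) b + d i b * d (n - i) a)) →
      (∀ n : ℕ, ∀ a b : A, d n (a * b + b * a) =
        ∑ i ∈ Finset.range (n + 1), (d i a * d (n - i) b + d i b * d (n - i) a)) := by
  intro C d hd hC
  have hPQ : P * Q = 0 := by rw [hQ, mul_sub, mul_one, hP, sub_self]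
  have hQP : Q * P = 0 := by rw [hQ, sub_mul, one_mul, hP, sub_self]
  have h1 : P + Q = 1 := by rw [hQ, add_sub_cancel]
  have sum_eq : ∀ n a b, ∑ i ∈ Finset.range (n + 1), (d i a * d (n - i) b + d i b * d (n - i) a) =
      ∑ p ∈ antidiagonal n, (d p.1 a * d p.2 b + d p.2 b * d p.1 a) := by
    intro n a b
    rw [← Finset.Nat.sum_antidiagonal_eq_sum_range_succ
      (fun i j => d i a * d j b + d i b * d j a), Finset.sum_add_distrib, Finset.sum_add_distrib,
      ← Finset.Nat.sum_antidiagonal_swap (f := fun p => d p.1 b * d p.2 a)]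
    rfl
  simp only [sum_eq] at hC ⊢
  suffices h : ∀ n, (∀ a b : A, d n (a * b + b * a) =
      ∑ p ∈ antidiagonal n, (d p.1 a * d p.2 b + d p.2 b * d p.1 a)) ∧
      ∀ a b : A, jordanDefect (logDerivative d n) a b = 0 from fun n => (h n).1
  intro n
  induction n using Nat.strong_induction_on with
  | _ n ih =>
    have key := jordanDefect_logDerivative hd n (fun m hm => (ih m hm).1) fun m hm => (ih m hm).2
    have hδ : ∀ a b, jordanDefect (logDerivative d n) a b = 0 :=
      jordanDefect_eq_zero hP hP0 hPQ hQP h1 h21 hinv₁ hinv₂ hlf hrf hcenter _ fun a b hab => by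
        rw [key, hC n a b hab, sub_self, smul_zero]
    refine ⟨fun a b => ?_, hδ⟩
    rcases Nat.eq_zero_or_pos n with rfl | hn
    · simp [hd]
    · have := (key a b).symm.trans (hδ a b)
      rw [← Nat.cast_smul_eq_nsmul 𝔽] at this
      exact sub_eq_zero.1 ((smul_eq_zero.1 this).resolve_left (Nat.cast_ne_zero.2 hn.ne'))
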